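/- arXiv:2305.05742 — 2 statements merged into one kernel-verified Lean document; each statement's English description precedes it below -/
import Mathlib

section
/- Let 𝒯_0 be a colored initial triangulation. Then every edge e ∈ ℰ(𝕄) of the master tree belongs to a type d simplex, i.e. there exists a d-simplex T ∈ 𝕄 with e ∈ ℰ(T) and gen(T) = level(e)·d. -/
noncomputable section

namespace BisecGrading

/-- Points of `ℝ^d`. -/
abbrev Pt (d : ℕ) : Type := Fin d → ℝ

/-- Integer ceiling `⌈g / d⌉` (for `d > 0`). -/
def lvlZ (d : ℕ) (g : ℤ) : ℤ := (g + d - 1) / d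

/-- The type `g - d * (⌈g/d⌉ - 1)` of a generation `g`. -/
def typZ (d : ℕ) (g : ℤ) : ℤ := g - d * (lvlZ d g - 1)

/-- A `d`-simplex, given by its ordered vertex list (in Maubach's ordering) together
with its generation counter. -/
structure Simplex (d : ℕ) where
  vertex : Fin (d + 1) → Pt d
  gen : ℕ

namespace Simplex

variable {d : ℕ}

instance : DecidableEq (Simplex d) := Classical.decEq _

/-- Maubach's index `k = d - (gen T % d)`. -/
def k (T : Simplex d) : ℕ := d - T.gen % d

lemma k_le (T : Simplex d) : T.k ≤ d := Nat.sub_le _ _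

/-- `k` as an index into the vertex list. -/
def kIdx (T : Simplex d) : Fin (d + 1) := ⟨T.k, Nat.lt_succ_of_le T.k_le⟩

/-- The bisection vertex `(v₀ + v_k)/2`. -/
def bsv (T : Simplex d) : Pt d := midpoint ℝ (T.vertex 0) (T.vertex T.kIdx)

/-- The bisection edge `[v₀, v_k]`, as an unordered pair of points. -/
def bse (T : Simplex d) : Sym2 (Pt d) := s(T.vertex 0, T.vertex T.kIdx)

/-- The first child `[v₀, …, v_{k-1}, v', v_{k+1}, …, v_d]` of Maubach's bisection. -/
def child1 (T : Simplex d) : Simplex d where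
  vertex := Function.update T.vertex T.kIdx T.bsv
  gen := T.gen + 1

/-- The second child `[v₁, …, v_k, v', v_{k+1}, …, v_d]` of Maubach's bisection. -/
def child2 (T : Simplex d) : Simplex d where
  vertex := fun i =>
    if h : (i : ℕ) < T.k then
      T.vertex ⟨(i : ℕ) + 1, by have hk := T.k_le; omega⟩
    else if (i : ℕ) = T.k then T.bsv
    else T.vertex i
  gen := T.gen + 1

/-- `T'` is a child of `T`. -/
def IsChild (T' T : Simplex d) : Prop := T' = T.child1 ∨ T' = T.child2

/-- The vertex set `𝒱(T)`. -/
def V (T : Simplex d) : Set (Pt d) := Set.range T.vertex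

/-- The edge set `ℰ(T)`. -/
def E (T : Simplex d) : Set (Sym2 (Pt d)) :=
  {e | ∃ i j : Fin (d + 1), i ≠ j ∧ e = s(T.vertex i, T.vertex j)}

/-- The closed simplex (convex hull of the vertices). -/
def hull (T : Simplex d) : Set (Pt d) := convexHull ℝ (Set.range T.vertex)

/-- The level `⌈gen/d⌉` of a `d`-simplex. -/
def lvl (T : Simplex d) : ℤ := lvlZ d T.gen

/-- The type of a `d`-simplex. -/
def typ (T : Simplex d) : ℤ := typZ d T.gen

end Simplex

variable {d : ℕ}

/-- Membership in the master tree generated from the initial triangulation `T0`. -/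
inductive MemM (T0 : Finset (Simplex d)) : Simplex d → Prop
  | init {T : Simplex d} : T ∈ T0 → MemM T0 T
  | child {T T' : Simplex d} : MemM T0 T → T'.IsChild T → MemM T0 T'

/-- `Refines 𝒯₁ 𝒯₂` : the partition `𝒯₂` is obtained from `𝒯₁` by finitely many
single bisections. -/
inductive Refines : Finset (Simplex d) → Finset (Simplex d) → Prop
  | refl (𝒯 : Finset (Simplex d)) : Refines 𝒯 𝒯
  | step {𝒯₁ 𝒯₂ : Finset (Simplex d)} (T : Simplex d) :
      Refines 𝒯₁ 𝒯₂ → T ∈ 𝒯₂ →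
      Refines 𝒯₁ (insert T.child1 (insert T.child2 (𝒯₂.erase T)))

/-- The subsimplex of `T` spanned by the vertex positions in `s`. -/
def faceSet (T : Simplex d) (s : Finset (Fin (d + 1))) : Set (Pt d) :=
  convexHull ℝ (T.vertex '' ↑s)

/-- Conformity: any two simplices meet in the empty set or in a common subsimplex. -/
def Conforming (𝒯 : Finset (Simplex d)) : Prop :=
  ∀ T₁ ∈ 𝒯, ∀ T₂ ∈ 𝒯,
    T₁.hull ∩ T₂.hull = ∅ ∨
      ∃ s₁ s₂ : Finset (Fin (d + 1)), s₁.Nonempty ∧ s₂.Nonempty ∧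
        T₁.hull ∩ T₂.hull = faceSet T₁ s₁ ∧ T₁.hull ∩ T₂.hull = faceSet T₂ s₂

/-- The conforming triangulations obtained from `T0` by successive bisections. -/
def Bisec (T0 : Finset (Simplex d)) : Set (Finset (Simplex d)) :=
  {𝒯 | Refines T0 𝒯 ∧ Conforming 𝒯}

/-- All vertices of a triangulation. -/
def verticesOf (𝒯 : Finset (Simplex d)) : Set (Pt d) := ⋃ T ∈ 𝒯, T.V

/-- All edges of a triangulation. -/
def edgesOf (𝒯 : Finset (Simplex d)) : Set (Sym2 (Pt d)) := ⋃ T ∈ 𝒯, T.E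

/-- Midpoint of an edge; this is the bisection vertex of the edge. -/
def edgeMid (e : Sym2 (Pt d)) : Pt d :=
  Sym2.lift ⟨fun a b => midpoint ℝ a b, fun a b => midpoint_comm a b⟩ e

/-- The closed segment covered by an edge. -/
def edgeSeg (e : Sym2 (Pt d)) : Set (Pt d) :=
  Sym2.lift ⟨fun a b => segment ℝ a b, fun a b => segment_symm ℝ a b⟩ e

/-- A colored conforming initial triangulation (with the vertices of each initial
simplex ordered so that the colors read `(d, 0, 1, …, d-1)`), together with the
induced generation function on all vertices of the master tree. -/
structure ColoredSetup (d : ℕ) where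
  T0 : Finset (Simplex d)
  indep : ∀ T ∈ T0, AffineIndependent ℝ T.vertex
  gen_zero : ∀ T ∈ T0, T.gen = 0
  conf : Conforming T0
  disjInt : ∀ T₁ ∈ T0, ∀ T₂ ∈ T0, T₁ ≠ T₂ → interior T₁.hull ∩ interior T₂.hull = ∅
  color : Pt d → ℕ
  color_zero : ∀ T ∈ T0, color (T.vertex 0) = d
  color_succ : ∀ T ∈ T0, ∀ i : Fin (d + 1), (i : ℕ) ≠ 0 → color (T.vertex i) = (i : ℕ) - 1
  vgen : Pt d → ℤ
  vgen_init : ∀ T ∈ T0, ∀ i : Fin (d + 1), vgen (T.vertex i) = -(color (T.vertex i) : ℤ)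
  vgen_bsv : ∀ T : Simplex d, MemM T0 T → vgen T.bsv = (T.gen : ℤ) + 1

namespace ColoredSetup

variable {d : ℕ} (S : ColoredSetup d)

/-- Level of a vertex. -/
def lvlV (v : Pt d) : ℤ := lvlZ d (S.vgen v)

/-- Type of a vertex. -/
def typV (v : Pt d) : ℤ := typZ d (S.vgen v)

/-- Generation of an edge: the maximal generation of its endpoints. -/
def genE (e : Sym2 (Pt d)) : ℤ :=
  Sym2.lift ⟨fun a b => max (S.vgen a) (S.vgen b), fun a b => max_comm _ _⟩ e

/-- Level of an edge. -/
def lvlE (e : Sym2 (Pt d)) : ℤ := lvlZ d (S.genE e)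

/-- Type of an edge. -/
def typE (e : Sym2 (Pt d)) : ℤ := typZ d (S.genE e)

/-- `gen#` of an edge: the generation of its bisection vertex (= its midpoint). -/
def genSharpE (e : Sym2 (Pt d)) : ℤ := S.vgen (edgeMid e)

/-- `level#` of an edge. -/
def lvlSharpE (e : Sym2 (Pt d)) : ℤ := lvlZ d (S.genSharpE e)

/-- `type#` of an edge. -/
def typSharpE (e : Sym2 (Pt d)) : ℤ := typZ d (S.genSharpE e)

end ColoredSetup

/-- Chains of pairwise intersecting simplices of length `N`. -/
def IsSimChain (𝒮 : Set (Simplex d)) (T T' : Simplex d) (N : ℕ) : Prop :=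
  ∃ f : Fin (N + 1) → Simplex d, (∀ i, f i ∈ 𝒮) ∧ f 0 = T ∧ f (Fin.last N) = T' ∧
    ∀ i : Fin N, ((f i.castSucc).hull ∩ (f i.succ).hull).Nonempty

/-- The simplex distance `δ_𝒯`. -/
def simDist (𝒯 : Finset (Simplex d)) (T T' : Simplex d) : ℕ :=
  sInf {N | IsSimChain (↑𝒯) T T' N}

/-- Chains of `1`-neighbours (consecutive simplices share an edge). -/
def Is1Chain (𝒮 : Set (Simplex d)) (T T' : Simplex d) (N : ℕ) : Prop :=
  ∃ f : Fin (N + 1) → Simplex d, (∀ i, f i ∈ 𝒮) ∧ f 0 = T ∧ f (Fin.last N) = T' ∧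
    ∀ i : Fin N, ((f i.castSucc).E ∩ (f i.succ).E).Nonempty

/-- The `1`-distance `δ¹_𝒮`. -/
def dist1 (𝒮 : Set (Simplex d)) (T T' : Simplex d) : ℕ :=
  sInf {N | Is1Chain 𝒮 T T' N}

/-- The uniform patch `ω_{𝒯₀⁺}(v)` in the full uniform refinement `𝒯₀⁺`. -/
def patchPlus (S : ColoredSetup d) (v : Pt d) : Set (Simplex d) :=
  {T | MemM S.T0 T ∧ T.gen = d ∧ v ∈ T.V}

/-- The constant `C(𝒯₀)`. -/
def Cconst (S : ColoredSetup d) : ℕ :=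
  sSup {n | ∃ v ∈ verticesOf S.T0, ∃ T ∈ patchPlus S v, ∃ T' ∈ patchPlus S v,
    n = dist1 (patchPlus S v) T T'}

/-- `v` lies in some `n`-subsimplex of an initial simplex. -/
def InMacroSub (S : ColoredSetup d) (n : ℕ) (v : Pt d) : Prop :=
  ∃ T ∈ S.T0, ∃ s : Finset (Fin (d + 1)), s.card = n + 1 ∧ v ∈ convexHull ℝ (T.vertex '' ↑s)

/-- `v` is an `n`-macro vertex. -/
def IsMacro (S : ColoredSetup d) (n : ℕ) (v : Pt d) : Prop :=
  InMacroSub S n v ∧ ∀ m : ℕ, m < n → ¬ InMacroSub S m v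

/-- The maximal level jump at a vertex `v`. -/
def jump (S : ColoredSetup d) (v : Pt d) : ℕ :=
  sSup {n | ∃ 𝒯 ∈ Bisec S.T0, ∃ e ∈ edgesOf 𝒯, ∃ e' ∈ edgesOf 𝒯,
    v ∈ e ∧ v ∈ e' ∧ (n : ℤ) = |S.lvlE e - S.lvlE e'|}

/-- The constants `J_n`. -/
def J (S : ColoredSetup d) (n : ℕ) : ℤ :=
  if n = 0 then ⌈((Cconst S : ℚ) + 1) * (1 - 1 / (d : ℚ))⌉ - 2
  else if n ≤ d - 2 then 2 else 0

/-- The constant `Γ = 1 + Σ_{n=0}^{d-2} J_n`. -/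
def Gam (S : ColoredSetup d) : ℤ := 1 + ∑ n ∈ Finset.range (d - 1), J S n

/-- The edges spanned by a set of points. -/
def edgeOfSet (A : Set (Pt d)) : Set (Sym2 (Pt d)) :=
  {e | ∃ a ∈ A, ∃ b ∈ A, a ≠ b ∧ e = s(a, b)}

/-- `FirstBisected A T e` : along descendants of `T` that keep all points of `A` as
vertices, `e` is the first edge spanned by points of `A` which occurs as a bisection
edge, i.e. the edge of the subsimplex spanned by `A` that is bisected first. -/
inductive FirstBisected (A : Set (Pt d)) : Simplex d → Sym2 (Pt d) → Prop
  | found {T : Simplex d} : T.bse ∈ edgeOfSet A → FirstBisected A T T.bse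
  | step {T T' : Simplex d} {e : Sym2 (Pt d)} :
      T.bse ∉ edgeOfSet A → T'.IsChild T → A ⊆ T'.V →
      FirstBisected A T' e → FirstBisected A T e

/-- The uniform vertex patch `ω_m(v)`. -/
def patchU (S : ColoredSetup d) (m : ℕ) (v : Pt d) : Set (Simplex d) :=
  {T | MemM S.T0 T ∧ T.gen = m * d ∧ v ∈ T.V}

/-- The patch boundary `∂ω_m(v)`: union of the `(d-1)`-subsimplices of members of
`ω_m(v)` not containing `v`. -/
def patchBd (S : ColoredSetup d) (m : ℕ) (v : Pt d) : Set (Pt d) :=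
  ⋃ T ∈ patchU S m v,
    ⋃ s ∈ {s : Finset (Fin (d + 1)) | s.card = d ∧ v ∉ convexHull ℝ (T.vertex '' ↑s)},
      convexHull ℝ (T.vertex '' ↑s)

/-- The neighbourhood `Ω_m(v)`. -/
def nbhd (S : ColoredSetup d) (m : ℕ) (v : Pt d) : Set (Pt d) :=
  (⋃ T ∈ patchU S m v, T.hull) \ patchBd S m v

/-- The Kuhn simplex `T_π = [0, e_{π(1)}, e_{π(1)}+e_{π(2)}, …]`, of generation `0`. -/
def kuhnSimplex (d : ℕ) (π : Equiv.Perm (Fin d)) : Simplex d where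
  vertex := fun i x => if ((π.symm x : ℕ)) < (i : ℕ) then 1 else 0
  gen := 0

/-- The average diameter `h₀` of the initial triangulation. -/
def avgDiam (T0 : Finset (Simplex d)) : ℝ :=
  (∑ T ∈ T0, Metric.diam T.hull) / T0.card

/-- The regularized mesh size function `h_𝒯`. -/
def regMesh (T0 𝒯 : Finset (Simplex d)) (T : Simplex d) : ℝ :=
  avgDiam T0 * sInf {x : ℝ | ∃ T' ∈ 𝒯, x = (2 : ℝ) ^ (-(T'.lvl) + (simDist 𝒯 T T' : ℤ))}

namespace Simplex

variable {d : ℕ} (T : Simplex d) {i : Fin (d + 1)}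

lemma child1_vertex_of_ne (hi : (i : ℕ) ≠ T.k) : T.child1.vertex i = T.vertex i :=
  Function.update_of_ne (fun h => hi (congrArg Fin.val h)) _ _

lemma child2_vertex_of_lt (hi : (i : ℕ) < T.k) :
    T.child2.vertex i = T.vertex ⟨i + 1, by have := T.k_le; omega⟩ :=
  dif_pos hi

lemma child2_vertex_of_gt (hi : T.k < (i : ℕ)) : T.child2.vertex i = T.vertex i := by
  simp only [child2]
  rw [dif_neg hi.not_gt, if_neg hi.ne']

variable {T} {T' : Simplex d}

lemma IsChild.gen_eq (h : T'.IsChild T) : T'.gen = T.gen + 1 := by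
  rcases h with rfl | rfl <;> rfl

lemma IsChild.vertex_of_eq (h : T'.IsChild T) (hi : (i : ℕ) = T.k) : T'.vertex i = T.bsv := by
  rcases h with rfl | rfl
  · obtain rfl : i = T.kIdx := Fin.ext hi
    exact Function.update_self _ _ _
  · simp [child2, hi]

lemma IsChild.vertex_of_gt (h : T'.IsChild T) (hi : T.k < (i : ℕ)) :
    T'.vertex i = T.vertex i := by
  rcases h with rfl | rfl
  · exact T.child1_vertex_of_ne hi.ne'
  · exact T.child2_vertex_of_gt hi

end Simplex

namespace ColoredSetup

variable {d : ℕ} (S : ColoredSetup d)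

/-- The generations of the vertices of a simplex whose generation is a multiple of `d`. -/
structure IsTop (A : Simplex d) (q : ℕ) : Prop where
  mem : MemM S.T0 A
  gen_eq : A.gen = q * d
  vgen_zero : S.vgen (A.vertex 0) ≤ (q * d : ℕ) - (d : ℤ)
  vgen_pos : ∀ i : Fin (d + 1), (i : ℕ) ≠ 0 →
    S.vgen (A.vertex i) = (q * d : ℕ) + 1 - ((i : ℕ) : ℤ)

/-- `T` arises from the simplex `A` of generation `q * d` by `r` bisections: its first `d - r + 1`
vertices are consecutive vertices of `A`, the others are the bisection vertices created since. -/
structure IsDescendant (A T : Simplex d) (q r : ℕ) : Prop where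
  top : S.IsTop A q
  mem : MemM S.T0 T
  gen_eq : T.gen = q * d + r
  old : ∃ s : ℕ, ∀ i : Fin (d + 1), (i : ℕ) ≤ d - r →
    ∃ j : Fin (d + 1), (j : ℕ) = i + s ∧ T.vertex i = A.vertex j
  new : ∀ i : Fin (d + 1), d - r < (i : ℕ) →
    S.vgen (T.vertex i) = (q * d : ℕ) + d + 1 - ((i : ℕ) : ℤ)

variable {S} {A T T' : Simplex d} {q r : ℕ}

lemma IsTop.vgen_le (hA : S.IsTop A q) (i : Fin (d + 1)) :
    S.vgen (A.vertex i) ≤ (q * d : ℕ) := by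
  by_cases hi : (i : ℕ) = 0
  · obtain rfl : i = 0 := Fin.ext hi
    have := hA.vgen_zero
    omega
  · have := hA.vgen_pos i hi
    omega

lemma IsTop.isDescendant (hA : S.IsTop A q) : S.IsDescendant A A q 0 where
  top := hA
  mem := hA.mem
  gen_eq := hA.gen_eq
  old := ⟨0, fun i _ => ⟨i, rfl, rfl⟩⟩
  new i hi := by omega

namespace IsDescendant

lemma k_eq (h : S.IsDescendant A T q r) (hr : r < d) : T.k = d - r := by
  rw [Simplex.k, h.gen_eq, Nat.mul_add_mod', Nat.mod_eq_of_lt hr]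

lemma vgen_old_le (h : S.IsDescendant A T q r) (i : Fin (d + 1)) (hi : (i : ℕ) ≤ d - r) :
    S.vgen (T.vertex i) ≤ (q * d : ℕ) := by
  obtain ⟨s, hs⟩ := h.old
  obtain ⟨j, -, hj⟩ := hs i hi
  exact hj ▸ h.top.vgen_le j

lemma child (h : S.IsDescendant A T q r) (hr : r < d) (hT' : T'.IsChild T) :
    S.IsDescendant A T' q (r + 1) := by
  have hk := h.k_eq hr
  have hb := S.vgen_bsv T h.mem
  have hg := h.gen_eq
  obtain ⟨s, hs⟩ := h.old
  refine ⟨h.top, .child h.mem hT', by rw [hT'.gen_eq, hg, add_assoc], ?_, ?_⟩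
  · rcases hT' with rfl | rfl
    · refine ⟨s, fun i hi => ?_⟩
      rw [T.child1_vertex_of_ne (by omega)]
      exact hs i (by omega)
    · refine ⟨s + 1, fun i hi => ?_⟩
      rw [T.child2_vertex_of_lt (by omega)]
      obtain ⟨j, hj, hij⟩ := hs ⟨i + 1, by omega⟩ (by simp only; omega)
      exact ⟨j, by simp only at hj; omega, hij⟩
  · intro i hi
    by_cases hik : (i : ℕ) = T.k
    · rw [hT'.vertex_of_eq hik, hb]
      omega
    · rw [hT'.vertex_of_gt (by omega), h.new i (by omega)]

lemma isTop (h : S.IsDescendant A T q d) : S.IsTop T (q + 1) where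
  mem := h.mem
  gen_eq := by rw [h.gen_eq, Nat.succ_mul]
  vgen_zero := by
    have := h.vgen_old_le 0 (by simp)
    rw [Nat.succ_mul]
    omega
  vgen_pos i hi := by
    have := h.new i (by omega)
    rw [this, Nat.succ_mul]
    omega

/-- An edge of `T` containing a vertex created after `A` survives until generation `q * d + d`. -/
lemma exists_edge_mem (h : S.IsDescendant A T q r) (hr : r ≤ d) {i j : Fin (d + 1)}
    (hij : i ≠ j) (hi : d - r < (i : ℕ)) :
    ∃ T', MemM S.T0 T' ∧ s(T.vertex i, T.vertex j) ∈ T'.E ∧ T'.gen = q * d + d := by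
  induction hr using Nat.decreasingInduction generalizing T i j with
  | self => exact ⟨T, h.mem, ⟨i, j, hij, rfl⟩, h.gen_eq⟩
  | of_succ r hr ih =>
    have hk := h.k_eq hr
    by_cases hj : (j : ℕ) = d - r
    · have h2 := ih (h.child hr (.inr rfl)) (i := i) (j := ⟨j - 1, by omega⟩)
        (by simp only [ne_eq, Fin.ext_iff]; omega) (by omega)
      rw [T.child2_vertex_of_gt (by omega), T.child2_vertex_of_lt (by simp only; omega)] at h2
      have hj1 : (j : ℕ) - 1 + 1 = j := by omega
      simpa only [hj1] using h2
    · have h1 := ih (h.child hr (.inl rfl)) hij (by omega)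
      rwa [T.child1_vertex_of_ne (by omega), T.child1_vertex_of_ne (by omega)] at h1

end IsDescendant

lemma exists_isDescendant (hd : 0 < d) (hT : MemM S.T0 T) :
    ∃ A q r, r < d ∧ S.IsDescendant A T q r := by
  induction hT with
  | init hT =>
    rename_i T
    have hA : S.IsTop T 0 := by
      refine ⟨.init hT, by simp [S.gen_zero T hT], ?_, fun i hi => ?_⟩
      · rw [S.vgen_init T hT, S.color_zero T hT]
        simp
      · rw [S.vgen_init T hT, S.color_succ T hT i hi]
        omega
    exact ⟨T, 0, 0, hd, hA.isDescendant⟩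
  | child _ hT' ih =>
    obtain ⟨A, q, r, hr, h⟩ := ih
    have h' := h.child hr hT'
    obtain hr' | rfl := Nat.lt_or_eq_of_le (Nat.succ_le_of_lt hr)
    · exact ⟨A, q, r + 1, hr', h'⟩
    · exact ⟨_, q + 1, 0, hd, h'.isTop.isDescendant⟩

end ColoredSetup

lemma lvlZ_eq {g : ℤ} {d q : ℕ} (h1 : ((q * d : ℕ) : ℤ) - d < g) (h2 : g ≤ (q * d : ℕ)) :
    lvlZ d g = q := by
  push_cast at h1 h2
  have hd : (0 : ℤ) < d := by linarith
  rw [lvlZ]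
  apply le_antisymm
  · rw [← Int.lt_add_one_iff, Int.ediv_lt_iff_lt_mul hd]
    linarith
  · rw [Int.le_ediv_iff_mul_le hd]
    linarith

theorem edge_in_type_d_simplex (d : ℕ) (hd : 2 ≤ d) (S : ColoredSetup d)
    (e : Sym2 (Pt d)) (he : ∃ T : Simplex d, MemM S.T0 T ∧ e ∈ T.E) :
    ∃ T : Simplex d, MemM S.T0 T ∧ e ∈ T.E ∧ (T.gen : ℤ) = S.lvlE e * d := by
  obtain ⟨T, hT, i, j, hij, rfl⟩ := he
  obtain ⟨A, q, r, hr, h⟩ := ColoredSetup.exists_isDescendant (by omega) hT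
  wlog hle : j ≤ i generalizing i j
  · rw [Sym2.eq_swap]
    exact this j i hij.symm (le_of_not_ge hle)
  have hgen : S.genE s(T.vertex i, T.vertex j) =
    max (S.vgen (T.vertex i)) (S.vgen (T.vertex j)) := rfl
  have hji : (j : ℕ) < i := lt_of_le_of_ne hle (Fin.val_ne_of_ne hij.symm)
  by_cases hi : d - r < (i : ℕ)
  · obtain ⟨T', hT', he, hg⟩ := h.exists_edge_mem hr.le hij hi
    refine ⟨T', hT', he, ?_⟩
    have hvi := h.new i hi
    have hvj : S.vgen (T.vertex j) ≤ (q * d : ℕ) + d := by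
      by_cases hj : d - r < (j : ℕ)
      · rw [h.new j hj]
        omega
      · have := h.vgen_old_le j (by omega)
        omega
    have hl : S.lvlE s(T.vertex i, T.vertex j) = (q + 1 : ℕ) := by
      rw [ColoredSetup.lvlE, hgen]
      apply lvlZ_eq <;> rw [Nat.succ_mul] <;> omega
    rw [hl, hg]
    push_cast
    ring
  · obtain ⟨s, hs⟩ := h.old
    obtain ⟨i', hi', hvi⟩ := hs i (by omega)
    obtain ⟨j', hj', hvj⟩ := hs j (by omega)
    refine ⟨A, h.top.mem, ⟨i', j', ?_, by rw [hvi, hvj]⟩, ?_⟩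
    · rw [ne_eq, Fin.ext_iff]
      omega
    have h1 := h.top.vgen_pos i' (by omega)
    have h2 := h.top.vgen_le j'
    have hl : S.lvlE s(T.vertex i, T.vertex j) = q := by
      rw [ColoredSetup.lvlE, hgen, hvi, hvj]
      apply lvlZ_eq <;> omega
    rw [hl, h.top.gen_eq]
    push_cast
    ring

end BisecGrading
end
end

section
/- Let 𝒯_0 be a colored initial triangulation and let T_1, T_2 ∈ 𝕄 be d-simplices such that T_1 ∩ T_2 is a nonempty common subsimplex of T_1 and T_2. Then: (1) if bse(T_1) ⊂ T_2 and bse(T_2) ∩ T_1 ≠ ∅, then bse(T_1) ∩ bse(T_2) ≠ ∅; (2) if additionally gen(T_1) = gen(T_2), then bse(T_1) = bse(T_2). -/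
noncomputable section

namespace BisecGrading

variable {d : ℕ}

section ConvexGeometry

variable {ι E : Type*} [AddCommGroup E] [Module ℝ E]

/-- A barycentric coordinate vanishes on every face that does not contain its vertex. -/
lemma coord_eq_zero_of_mem_convexHull_image (b : AffineBasis ι ℝ E) {s : Set ι} {i : ι}
    (hi : i ∉ s) {x : E} (hx : x ∈ convexHull ℝ (b '' s)) : b.coord i x = 0 := by
  have hsub : convexHull ℝ (b '' s) ⊆ (b.coord i) ⁻¹' {0} := by
    refine convexHull_min ?_ ((convex_singleton (0 : ℝ)).affine_preimage _)
    rintro _ ⟨j, hj, rfl⟩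
    exact b.coord_apply_ne fun h => hi (h ▸ hj)
  exact hsub hx

/-- Two faces of a nondegenerate simplex that meet share a vertex. -/
lemma exists_mem_of_mem_convexHull_image [Fintype ι] (b : AffineBasis ι ℝ E) {s t : Set ι} {x : E}
    (hs : x ∈ convexHull ℝ (b '' s)) (ht : x ∈ convexHull ℝ (b '' t)) : ∃ i ∈ s, i ∈ t := by
  by_contra! h
  have hsum := b.sum_coord_apply_eq_one x
  rw [Finset.sum_eq_zero] at hsum
  · exact zero_ne_one hsum
  · intro i _
    by_cases hi : i ∈ s
    · exact coord_eq_zero_of_mem_convexHull_image b (h i hi) ht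
    · exact coord_eq_zero_of_mem_convexHull_image b hi hs

/-- A vertex of a nondegenerate simplex lying in the convex hull of a subset `A` of the simplex
belongs to `A`. -/
lemma vertex_mem_of_mem_convexHull [Fintype ι] (b : AffineBasis ι ℝ E) {A : Set E}
    (hA : A ⊆ convexHull ℝ (Set.range b)) {i : ι} (hi : b i ∈ convexHull ℝ A) : b i ∈ A := by
  classical
  have hnonneg : ∀ a ∈ A, ∀ j, 0 ≤ b.coord j a := fun a ha => by
    have := hA ha
    rwa [b.convexHull_eq_nonneg_coord] at this
  obtain ⟨a, ha, h1⟩ : ∃ a ∈ A, 1 ≤ b.coord i a := by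
    by_contra! h
    have hsub : convexHull ℝ A ⊆ (b.coord i) ⁻¹' Set.Iio 1 :=
      convexHull_min h ((convex_Iio (1 : ℝ)).affine_preimage _)
    have := hsub hi
    simp at this
  have hsum := b.sum_coord_apply_eq_one a
  rw [← Finset.add_sum_erase _ _ (Finset.mem_univ i)] at hsum
  have hrest := Finset.sum_nonneg fun j (_ : j ∈ Finset.univ.erase i) => hnonneg a ha j
  have hzero := (Finset.sum_eq_zero_iff_of_nonneg
    fun j (_ : j ∈ Finset.univ.erase i) => hnonneg a ha j).1 (by linarith)
  have hab : a = b i := by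
    refine b.ext_elem fun j => ?_
    by_cases hj : j = i
    · subst hj
      rw [b.coord_apply_eq]
      linarith
    · rw [b.coord_apply_ne hj]
      exact hzero j (by simp [hj])
  exact hab ▸ ha

end ConvexGeometry

namespace Simplex

lemma k_eq {T : Simplex d} {l r : ℕ} (hr : r < d) (h : T.gen = d * l + r) : T.k = d - r := by
  simp [k, h, Nat.mod_eq_of_lt hr]

lemma vertex_kIdx_mem_affineSpan {T : Simplex d} {s : AffineSubspace ℝ (Pt d)}
    (h0 : T.vertex 0 ∈ s) (hm : T.bsv ∈ s) : T.vertex T.kIdx ∈ s := by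
  have h := AffineMap.lineMap_mem (2 : ℝ) h0 hm
  convert h using 1
  ext x
  simp [bsv, AffineMap.lineMap_apply, midpoint_eq_smul_add]
  ring

lemma vertex_zero_mem_affineSpan {T : Simplex d} {s : AffineSubspace ℝ (Pt d)}
    (hk : T.vertex T.kIdx ∈ s) (hm : T.bsv ∈ s) : T.vertex 0 ∈ s := by
  have h := AffineMap.lineMap_mem (2 : ℝ) hk hm
  convert h using 1
  ext x
  simp [bsv, AffineMap.lineMap_apply, midpoint_eq_smul_add]
  ring

lemma affineSpan_child1 {T : Simplex d} (hk : 0 < T.k)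
    (h : affineSpan ℝ (Set.range T.vertex) = ⊤) :
    affineSpan ℝ (Set.range T.child1.vertex) = ⊤ := by
  rw [eq_top_iff, ← h, affineSpan_le]
  have hne : ∀ i, i ≠ T.kIdx → T.vertex i ∈ affineSpan ℝ (Set.range T.child1.vertex) :=
    fun i hi => subset_affineSpan ℝ _ ⟨i, by simp [child1, hi]⟩
  have hm : T.bsv ∈ affineSpan ℝ (Set.range T.child1.vertex) :=
    subset_affineSpan ℝ _ ⟨T.kIdx, by simp [child1]⟩
  rintro _ ⟨i, rfl⟩
  by_cases hi : i = T.kIdx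
  · subst hi
    refine vertex_kIdx_mem_affineSpan (hne 0 fun h0 => ?_) hm
    have := congrArg Fin.val h0
    simp only [kIdx, Fin.val_zero] at this
    omega
  · exact hne i hi

lemma affineSpan_child2 {T : Simplex d} (hk : 0 < T.k)
    (h : affineSpan ℝ (Set.range T.vertex) = ⊤) :
    affineSpan ℝ (Set.range T.child2.vertex) = ⊤ := by
  rw [eq_top_iff, ← h, affineSpan_le]
  have hkd := T.k_le
  have hne : ∀ i, i ≠ 0 → T.vertex i ∈ affineSpan ℝ (Set.range T.child2.vertex) := by
    intro i hi
    have hi' : (i : ℕ) ≠ 0 := fun h0 => hi (Fin.ext h0)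
    by_cases hik : (i : ℕ) ≤ T.k
    · refine subset_affineSpan ℝ _ ⟨⟨(i : ℕ) - 1, by omega⟩, ?_⟩
      have hlt : (i : ℕ) - 1 < T.k := by omega
      simp only [child2, hlt, dite_true]
      congr 1
      ext
      simp
      omega
    · refine subset_affineSpan ℝ _ ⟨i, ?_⟩
      have h1 : ¬ (i : ℕ) < T.k := by omega
      have h2 : ¬ (i : ℕ) = T.k := by omega
      simp [child2, h1, h2]
  have hm : T.bsv ∈ affineSpan ℝ (Set.range T.child2.vertex) :=
    subset_affineSpan ℝ _ ⟨T.kIdx, by simp [child2, kIdx]⟩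
  rintro _ ⟨i, rfl⟩
  by_cases hi : i = 0
  · subst hi
    refine vertex_zero_mem_affineSpan (hne _ fun h0 => ?_) hm
    have := congrArg Fin.val h0
    simp only [kIdx, Fin.val_zero] at this
    omega
  · exact hne i hi

end Simplex

/-- The vertices of a simplex of the master tree affinely span the whole space. -/
lemma MemM.affineSpan_eq_top (hd : 0 < d) {T0 : Finset (Simplex d)}
    (hind : ∀ T ∈ T0, AffineIndependent ℝ T.vertex) {T : Simplex d} (hT : MemM T0 T) :
    affineSpan ℝ (Set.range T.vertex) = ⊤ := by
  induction hT with
  | init h => exact (hind _ h).affineSpan_eq_top_iff_card_eq_finrank_add_one.2 (by simp)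
  | @child T T' _ hc ih =>
    have hk : 0 < T.k := Nat.sub_pos_of_lt (Nat.mod_lt _ hd)
    rcases hc with rfl | rfl
    · exact Simplex.affineSpan_child1 hk ih
    · exact Simplex.affineSpan_child2 hk ih

/-- The affine basis formed by the vertices of a `d`-simplex spanning `ℝ^d`. -/
def Simplex.affineBasis (T : Simplex d) (h : affineSpan ℝ (Set.range T.vertex) = ⊤) :
    AffineBasis (Fin (d + 1)) ℝ (Pt d) where
  toFun := T.vertex
  ind' := by
    rw [affineIndependent_iff_finrank_vectorSpan_eq ℝ T.vertex (n := d) (by simp),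
      AffineSubspace.vectorSpan_eq_top_of_affineSpan_eq_top ℝ _ _ h, finrank_top]
    simp
  tot' := h

/-- The value `g` is an admissible vertex generation at position `i` of a simplex of generation
`D + d - k` with `d ∣ D`: positions beyond `k` carry the bisection vertices of the running level,
positions up to `k` a window, shifted by `j`, of the vertices of the simplex at generation `D`. -/
def PosGen (d : ℕ) (D : ℤ) (k j i : ℕ) (g : ℤ) : Prop :=
  (k < i ∧ g = D + d - i + 1) ∨ (i ≤ k ∧ 1 ≤ i + j ∧ g = D - (i + j) + 1) ∨
    (i = 0 ∧ j = 0 ∧ g ≤ D - d)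

/-- The generations of the vertices of a simplex of the master tree. -/
lemma MemM.posGen (hd : 0 < d) {S : ColoredSetup d} {T : Simplex d} (hT : MemM S.T0 T) :
    ∃ l r j : ℕ, r < d ∧ T.gen = d * l + r ∧ T.k = d - r ∧ j + T.k ≤ d ∧
      ∀ i : Fin (d + 1), PosGen d (d * l : ℕ) T.k j i (S.vgen (T.vertex i)) := by
  induction hT with
  | @init T h =>
    have hg := S.gen_zero T h
    have hk : T.k = d := by simp [Simplex.k, hg]
    refine ⟨0, 0, 0, hd, by simp [hg], by simp [hk], by simp [hk], fun i => ?_⟩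
    have hi := i.isLt
    rw [S.vgen_init T h, hk]
    by_cases h0 : i = 0
    · subst h0
      rw [S.color_zero T h]
      right; right; simp
    · have h0' : (i : ℕ) ≠ 0 := fun h => h0 (Fin.ext h)
      rw [S.color_succ T h i h0']
      right; left
      push_cast
      omega
  | @child T T' hT hc ih =>
    obtain ⟨l, r, j, hr, hg, hk, hj, hv⟩ := ih
    have hm := S.vgen_bsv T hT
    rw [hg] at hm
    have hkd := T.k_le
    have hgen : T'.gen = d * l + r + 1 := by
      rcases hc with rfl | rfl <;> simp [Simplex.child1, Simplex.child2, hg]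
    have hv' : ∃ s : ℕ, s ≤ 1 ∧ ∀ i : Fin (d + 1),
        ((i : ℕ) < T.k ∧ PosGen d (d * l : ℕ) T.k j (i + s) (S.vgen (T'.vertex i))) ∨
        ((i : ℕ) = T.k ∧ S.vgen (T'.vertex i) = (d * l + r : ℕ) + 1) ∨
        (T.k < (i : ℕ) ∧ PosGen d (d * l : ℕ) T.k j i (S.vgen (T'.vertex i))) := by
      rcases hc with rfl | rfl
      · refine ⟨0, by simp, fun i => ?_⟩
        by_cases hi : i = T.kIdx
        · right; left
          subst hi
          simp [Simplex.child1, hm, Simplex.kIdx]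
        · have hi' : (i : ℕ) ≠ T.k := fun h => hi (Fin.ext h)
          have he : T.child1.vertex i = T.vertex i := by simp [Simplex.child1, hi]
          rw [he]
          have := hv i
          rcases Nat.lt_or_gt_of_ne hi' with h | h
          · exact Or.inl ⟨h, this⟩
          · exact Or.inr (Or.inr ⟨h, this⟩)
      · refine ⟨1, by simp, fun i => ?_⟩
        rcases Nat.lt_trichotomy (i : ℕ) T.k with h | h | h
        · left
          refine ⟨h, ?_⟩
          simp only [Simplex.child2, h, dite_true]
          exact hv ⟨(i : ℕ) + 1, _⟩
        · right; left
          simp [Simplex.child2, h, hm]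
        · right; right
          refine ⟨h, ?_⟩
          have h1 : ¬ (i : ℕ) < T.k := by omega
          have h2 : ¬ (i : ℕ) = T.k := by omega
          simp only [Simplex.child2, h1, h2, dite_false, if_false]
          exact hv i
    obtain ⟨s, hs, hv'⟩ := hv'
    by_cases hlast : r + 1 < d
    · have hk' : T'.k = d - (r + 1) := Simplex.k_eq hlast hgen
      refine ⟨l, r + 1, j + s, hlast, hgen, hk', by omega, fun i => ?_⟩
      have hi := i.isLt
      have := hv' i
      rw [hk']
      rw [hk] at this
      generalize S.vgen (T'.vertex i) = g at *
      generalize d * l = D at *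
      unfold PosGen at *
      omega
    · have hgen' : T'.gen = d * (l + 1) + 0 := by rw [hgen, Nat.mul_add]; omega
      have hk' : T'.k = d := Simplex.k_eq hd hgen'
      refine ⟨l + 1, 0, 0, hd, hgen', hk', by omega, fun i => ?_⟩
      have hi := i.isLt
      have := hv' i
      rw [hk', Nat.mul_add, Nat.mul_one]
      rw [hk] at this
      generalize S.vgen (T'.vertex i) = g at *
      generalize d * l = D at *
      unfold PosGen at *
      omega

/-- If the bisection edge of one simplex consists of vertices at positions `a`, `c` of another one,
and the bisection edge of the latter contains a vertex of the former, then the two bisection edges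
share a vertex, and they agree if the generations do. -/
lemma posGen_bisection_edge {d : ℕ} {D₁ D₂ : ℤ} {k₁ j₁ k₂ j₂ a c b e : ℕ} {x y z w : ℤ}
    (hD : D₁ = D₂ ∨ D₁ + d ≤ D₂ ∨ D₂ + d ≤ D₁)
    (hk₁ : 0 < k₁) (hj₁ : j₁ + k₁ ≤ d) (hk₂ : 0 < k₂) (hj₂ : j₂ + k₂ ≤ d)
    (ha : a ≤ d) (hc : c ≤ d) (hb : b ≤ d) (he : e = 0 ∨ e = k₂)
    (hx₁ : PosGen d D₁ k₁ j₁ 0 x) (hx₂ : PosGen d D₂ k₂ j₂ a x)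
    (hy₁ : PosGen d D₁ k₁ j₁ k₁ y) (hy₂ : PosGen d D₂ k₂ j₂ c y)
    (hz₁ : PosGen d D₁ k₁ j₁ b z) (hz₂ : PosGen d D₂ k₂ j₂ e z)
    (hw : PosGen d D₂ k₂ j₂ 0 w) (hbz : b = 0 → z = x) (hez : e = 0 → z = w) :
    (a = 0 ∨ a = k₂ ∨ c = 0 ∨ c = k₂) ∧
      (D₁ = D₂ → k₁ = k₂ → (a = 0 ∧ c = k₂) ∨ (a = k₂ ∧ c = 0)) := by
  unfold PosGen at *
  rcases hD with rfl | hD | hD <;> rcases he with rfl | rfl <;>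
    rcases hx₁ with hx₁ | hx₁ | hx₁ <;> rcases hx₂ with hx₂ | hx₂ | hx₂ <;>
    omega

theorem bisection_edge_intersection (d : ℕ) (hd : 2 ≤ d) (S : ColoredSetup d)
    (T₁ T₂ : Simplex d) (h₁ : MemM S.T0 T₁) (h₂ : MemM S.T0 T₂)
    (hne : (T₁.hull ∩ T₂.hull).Nonempty)
    (hcommon : ∃ s₁ s₂ : Finset (Fin (d + 1)), s₁.Nonempty ∧ s₂.Nonempty ∧
      T₁.hull ∩ T₂.hull = faceSet T₁ s₁ ∧ T₁.hull ∩ T₂.hull = faceSet T₂ s₂) :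
    (edgeSeg T₁.bse ⊆ T₂.hull → (edgeSeg T₂.bse ∩ T₁.hull).Nonempty →
      (edgeSeg T₁.bse ∩ edgeSeg T₂.bse).Nonempty) ∧
    (edgeSeg T₁.bse ⊆ T₂.hull → (edgeSeg T₂.bse ∩ T₁.hull).Nonempty →
      T₁.gen = T₂.gen → T₁.bse = T₂.bse) := by
  have hd0 : 0 < d := by omega
  have hspan₁ := h₁.affineSpan_eq_top hd0 S.indep
  have hspan₂ := h₂.affineSpan_eq_top hd0 S.indep
  obtain ⟨l₁, r₁, j₁, hr₁, hg₁, hk₁, hj₁, hv₁⟩ := h₁.posGen hd0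
  obtain ⟨l₂, r₂, j₂, hr₂, hg₂, hk₂, hj₂, hv₂⟩ := h₂.posGen hd0
  obtain ⟨s₁, s₂, -, -, hF₁, hF₂⟩ := hcommon
  have hmem₁ : ∀ i, T₁.vertex i ∈ T₂.hull → ∃ a, T₂.vertex a = T₁.vertex i := by
    intro i hi
    have hF : T₁.vertex i ∈ faceSet T₂ s₂ := hF₂ ▸ ⟨subset_convexHull ℝ _ ⟨i, rfl⟩, hi⟩
    obtain ⟨a, -, ha⟩ := vertex_mem_of_mem_convexHull (T₁.affineBasis hspan₁)
      (((subset_convexHull ℝ _).trans hF₂.ge).trans Set.inter_subset_left) hF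
    exact ⟨a, ha⟩
  have hmem₂ : ∀ i, T₂.vertex i ∈ T₁.hull → ∃ b, T₁.vertex b = T₂.vertex i := by
    intro i hi
    have hF : T₂.vertex i ∈ faceSet T₁ s₁ := hF₁ ▸ ⟨hi, subset_convexHull ℝ _ ⟨i, rfl⟩⟩
    obtain ⟨b, -, hb⟩ := vertex_mem_of_mem_convexHull (T₂.affineBasis hspan₂)
      (((subset_convexHull ℝ _).trans hF₁.ge).trans Set.inter_subset_right) hF
    exact ⟨b, hb⟩
  suffices key : edgeSeg T₁.bse ⊆ T₂.hull → (edgeSeg T₂.bse ∩ T₁.hull).Nonempty →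
      (edgeSeg T₁.bse ∩ edgeSeg T₂.bse).Nonempty ∧ (T₁.gen = T₂.gen → T₁.bse = T₂.bse) from
    ⟨fun h h' => (key h h').1, fun h h' => (key h h').2⟩
  rintro hsub ⟨p, hp, hpT₁⟩
  obtain ⟨a, ha⟩ := hmem₁ 0 (hsub (left_mem_segment ℝ _ _))
  obtain ⟨c, hc⟩ := hmem₁ T₁.kIdx (hsub (right_mem_segment ℝ _ _))
  obtain ⟨e, he, b, hb⟩ : ∃ e, (e = 0 ∨ e = T₂.kIdx) ∧ ∃ b, T₁.vertex b = T₂.vertex e := by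
    have hp' : p ∈ convexHull ℝ (T₂.vertex '' {0, T₂.kIdx}) := by
      rw [Set.image_pair, convexHull_pair]
      exact hp
    have hpT₂ : p ∈ T₂.hull := convexHull_mono (Set.image_subset_range _ _) hp'
    have hpF : p ∈ faceSet T₂ s₂ := hF₂ ▸ ⟨hpT₁, hpT₂⟩
    obtain ⟨e, he, hes⟩ := exists_mem_of_mem_convexHull_image (T₂.affineBasis hspan₂) hp' hpF
    have heF : T₂.vertex e ∈ faceSet T₂ s₂ := subset_convexHull ℝ _ ⟨e, hes, rfl⟩
    exact ⟨e, he, hmem₂ e (hF₂ ▸ heF : T₂.vertex e ∈ T₁.hull ∩ T₂.hull).1⟩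
  have hx₂ := hv₂ a
  have hy₂ := hv₂ c
  have hz₁ := hv₁ b
  rw [ha] at hx₂
  rw [hc] at hy₂
  rw [hb] at hz₁
  have hlevel : ((d * l₁ : ℕ) : ℤ) = (d * l₂ : ℕ) ∨ ((d * l₁ : ℕ) : ℤ) + d ≤ (d * l₂ : ℕ) ∨
      ((d * l₂ : ℕ) : ℤ) + d ≤ (d * l₁ : ℕ) := by
    rcases Nat.lt_trichotomy l₁ l₂ with h | rfl | h
    · have := Nat.mul_le_mul_left d h
      rw [Nat.mul_succ] at this
      omega
    · exact Or.inl rfl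
    · have := Nat.mul_le_mul_left d h
      rw [Nat.mul_succ] at this
      omega
  obtain ⟨hshare, hsame⟩ := posGen_bisection_edge hlevel (by omega) hj₁ (by omega) hj₂
    (by omega) (by omega) (by omega) (he.imp (congrArg Fin.val) (congrArg Fin.val))
    (hv₁ 0) hx₂ (hv₁ T₁.kIdx) hy₂ hz₁ (hv₂ e) (hv₂ 0)
    (fun h => by rw [← hb, Fin.ext (b := 0) h]) (fun h => by rw [Fin.ext (b := 0) h])
  refine ⟨?_, fun hgen => ?_⟩
  · rcases hshare with h | h | h | h
    · obtain rfl : a = 0 := Fin.ext h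
      exact ⟨_, left_mem_segment ℝ _ _, ha ▸ left_mem_segment ℝ _ _⟩
    · obtain rfl : a = T₂.kIdx := Fin.ext h
      exact ⟨_, left_mem_segment ℝ _ _, ha ▸ right_mem_segment ℝ _ _⟩
    · obtain rfl : c = 0 := Fin.ext h
      exact ⟨_, right_mem_segment ℝ _ _, hc ▸ left_mem_segment ℝ _ _⟩
    · obtain rfl : c = T₂.kIdx := Fin.ext h
      exact ⟨_, right_mem_segment ℝ _ _, hc ▸ right_mem_segment ℝ _ _⟩
  · rcases hsame (by omega) (by omega) with ⟨h, h'⟩ | ⟨h, h'⟩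
    · obtain rfl : a = 0 := Fin.ext h
      obtain rfl : c = T₂.kIdx := Fin.ext h'
      rw [Simplex.bse, Simplex.bse, ha, hc]
    · obtain rfl : a = T₂.kIdx := Fin.ext h
      obtain rfl : c = 0 := Fin.ext h'
      rw [Simplex.bse, Simplex.bse, ha, hc, Sym2.eq_swap]

end BisecGrading
end
end
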